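/- Every nonempty bounded open set Ω ⊆ ℝⁿ (n ≥ 2) admits a (possibly non-unique) Cheeger set, i.e. there exists a Borel set E ⊆ Ω with |E| > 0 and P(E)/|E| = h(Ω). -/

import Mathlib

open MeasureTheory Metric Set Filter
open scoped ENNReal NNReal Topology Pointwise

noncomputable section

/-- The divergence of a vector field on `ℝⁿ`. -/
def divergence {n : ℕ} (g : EuclideanSpace ℝ (Fin n) → EuclideanSpace ℝ (Fin n))
    (x : EuclideanSpace ℝ (Fin n)) : ℝ :=
  LinearMap.trace ℝ (EuclideanSpace ℝ (Fin n)) (fderiv ℝ g x).toLinearMap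

/-- The (distributional) perimeter of a set `F ⊆ ℝⁿ`:
`P(F) = sup {∫_F div g : g ∈ C¹_c(ℝⁿ;ℝⁿ), ‖g‖ ≤ 1}`. -/
def perimeter {n : ℕ} (F : Set (EuclideanSpace ℝ (Fin n))) : ℝ≥0∞ :=
  ⨆ g ∈ {g : EuclideanSpace ℝ (Fin n) → EuclideanSpace ℝ (Fin n) |
      ContDiff ℝ 1 g ∧ HasCompactSupport g ∧ ∀ x, ‖g x‖ ≤ 1},
    ENNReal.ofReal (∫ x in F, divergence g x)

/-- The Cheeger constant of `Ω`:
`h(Ω) = inf {P(F) / |F| : F ⊆ Ω Borel, |F| > 0}`. -/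
def cheegerConstant {n : ℕ} (Ω : Set (EuclideanSpace ℝ (Fin n))) : ℝ≥0∞ :=
  ⨅ F ∈ {F : Set (EuclideanSpace ℝ (Fin n)) | MeasurableSet F ∧ F ⊆ Ω ∧ 0 < volume F},
    perimeter F / volume F

/-- `F` is a Cheeger set in `Ω`: a Borel subset of `Ω` of positive volume
whose ratio `P(F)/|F|` attains the Cheeger constant of `Ω`. -/
def IsCheegerSet {n : ℕ} (Ω F : Set (EuclideanSpace ℝ (Fin n))) : Prop :=
  MeasurableSet F ∧ F ⊆ Ω ∧ 0 < volume F ∧ perimeter F / volume F = cheegerConstant Ω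

section Compactness

theorem exists_subseq_tendsto_measureReal_inter {α : Type*} [MeasurableSpace α]
    [MeasurableSpace.CountablyGenerated α] {μ : Measure α} [SigmaFinite μ] {Ω : Set α}
    (hΩ : μ Ω ≠ ∞) {E : ℕ → Set α} (hE : ∀ k, MeasurableSet (E k)) (hEΩ : ∀ k, E k ⊆ Ω) :
    ∃ φ : ℕ → ℕ, StrictMono φ ∧ ∀ A, MeasurableSet A → μ A ≠ ∞ →
      ∃ l : ℝ, Tendsto (fun k => μ.real (E (φ k) ∩ A)) atTop (𝓝 l) := by
  have hfin (k) : μ (E k) ≠ ∞ := measure_ne_top_of_subset (hEΩ k) hΩ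
  have : Fact ((1 : ℝ≥0∞) ≤ 2) := ⟨by norm_num⟩
  have : Fact ((2 : ℝ≥0∞) ≠ ∞) := ⟨by norm_num⟩
  let f : ℕ → Lp ℝ 2 μ := fun k => indicatorConstLp 2 (hE k) (hfin k) (1 : ℝ)
  let Λ : ℕ → WeakDual ℝ (Lp ℝ 2 μ) := fun k =>
    StrongDual.toWeakDual (InnerProductSpace.toDual ℝ (Lp ℝ 2 μ) (f k))
  have hΛ (k) : Λ k ∈ WeakDual.toStrongDual ⁻¹'
      closedBall (0 : StrongDual ℝ (Lp ℝ 2 μ)) (μ.real Ω ^ (1 / (2 : ℝ≥0∞).toReal)) := by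
    rw [mem_preimage, mem_closedBall_zero_iff]
    change ‖InnerProductSpace.toDual ℝ (Lp ℝ 2 μ) (f k)‖ ≤ _
    rw [LinearIsometryEquiv.norm_map, norm_indicatorConstLp (by norm_num) (by norm_num), norm_one,
      one_mul]
    gcongr
    exact hEΩ k
  obtain ⟨L, -, φ, hφ, hL⟩ := WeakDual.isSeqCompact_closedBall ℝ (Lp ℝ 2 μ) 0 _ hΛ
  refine ⟨φ, hφ, fun A hA hAfin => ⟨L (indicatorConstLp 2 hA hAfin (1 : ℝ)), ?_⟩⟩
  have := ((WeakDual.eval_continuous (indicatorConstLp 2 hA hAfin (1 : ℝ))).tendsto L).comp hL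
  refine this.congr fun k => ?_
  exact L2.real_inner_indicatorConstLp_one_indicatorConstLp_one (hE _) hA (hfin _) hAfin

/-- A sequence of sets which is Cauchy for the measure of set differences has a subsequence
converging almost everywhere. -/
theorem exists_subseq_ae_eventually_mem_iff {α : Type*} [MeasurableSpace α] {μ : Measure α}
    {E : ℕ → Set α}
    (hC : ∀ ε : ℝ≥0∞, 0 < ε → ∃ N, ∀ k ≥ N, ∀ l ≥ N, μ (E k \ E l) ≤ ε) :
    ∃ φ : ℕ → ℕ, StrictMono φ ∧
      ∀ᵐ x ∂μ, ∀ᶠ k in atTop, (x ∈ E (φ k) ↔ x ∈ liminf (fun k => E (φ k)) atTop) := by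
  obtain ⟨φ, hφ, h⟩ := extraction_forall_of_eventually'
    (P := fun j N => ∀ k ≥ N, ∀ l ≥ N, μ (E k \ E l) ≤ 2⁻¹ ^ j) (fun j => by
      obtain ⟨N, hN⟩ := hC (2⁻¹ ^ j) (ENNReal.pow_pos (by norm_num) j)
      exact ⟨N, fun M hM k hk l hl => hN k (hM.trans hk) l (hM.trans hl)⟩)
  refine ⟨φ, hφ, ?_⟩
  set S : ℕ → Set α := fun k => (E (φ k) \ E (φ (k + 1))) ∪ (E (φ (k + 1)) \ E (φ k)) with hS
  have hSsum : ∑' k, μ (S k) ≠ ∞ := by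
    refine ne_top_of_le_ne_top (b := ∑' k : ℕ, (2⁻¹ ^ k + 2⁻¹ ^ k : ℝ≥0∞)) ?_ ?_
    · rw [ENNReal.tsum_add, ENNReal.tsum_geometric]
      simp
    · refine ENNReal.tsum_le_tsum fun k => (measure_union_le _ _).trans ?_
      have h1 := hφ (Nat.lt_succ_self k)
      exact add_le_add (h k _ le_rfl _ h1.le) (h k _ h1.le _ le_rfl)
  filter_upwards [ae_eventually_notMem hSsum] with x hx
  obtain ⟨N, hN⟩ := eventually_atTop.1 hx
  have hstep (k) (hk : N ≤ k) : x ∈ E (φ k) ↔ x ∈ E (φ N) := by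
    induction k, hk using Nat.le_induction with
    | base => rfl
    | succ k hk ih =>
      have := hN k hk
      simp only [hS, mem_union, Set.mem_sdiff, not_or, not_and, not_not] at this
      exact ⟨fun hh => ih.1 (this.2 hh), fun hh => this.1 (ih.2 hh)⟩
  have hlim : x ∈ liminf (fun k => E (φ k)) atTop ↔ x ∈ E (φ N) := by
    rw [mem_liminf_iff_eventually_mem]
    constructor
    · intro hh
      obtain ⟨k, hk, hkN⟩ := (hh.and (eventually_ge_atTop N)).exists
      exact (hstep k hkN).1 hk
    · intro hh
      filter_upwards [eventually_ge_atTop N] with k hk using (hstep k hk).2 hh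
  filter_upwards [eventually_ge_atTop N] with k hk
  rw [hstep k hk, hlim]

end Compactness

open scoped Manifold

section Perimeter

variable {n : ℕ}

theorem divergence_smul_const {φ : EuclideanSpace ℝ (Fin n) → ℝ} (hφ : ContDiff ℝ 1 φ)
    (v x : EuclideanSpace ℝ (Fin n)) :
    divergence (fun z => φ z • v) x = fderiv ℝ φ x v := by
  have h : HasFDerivAt (fun z => φ z • v) ((fderiv ℝ φ x).smulRight v) x :=
    ((hφ.differentiable one_ne_zero) x).hasFDerivAt.smul_const v
  rw [divergence, h.fderiv]
  exact LinearMap.trace_smulRight (fderiv ℝ φ x).toLinearMap v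

theorem ofReal_setIntegral_divergence_le_perimeter {F : Set (EuclideanSpace ℝ (Fin n))}
    {g : EuclideanSpace ℝ (Fin n) → EuclideanSpace ℝ (Fin n)} (hg : ContDiff ℝ 1 g)
    (hgc : HasCompactSupport g) (hg1 : ∀ x, ‖g x‖ ≤ 1) :
    ENNReal.ofReal (∫ x in F, divergence g x) ≤ perimeter F :=
  le_iSup₂_of_le (f := fun g _ => ENNReal.ofReal (∫ x in F, divergence g x)) g ⟨hg, hgc, hg1⟩ le_rfl

theorem setIntegral_fderiv_apply_le {F : Set (EuclideanSpace ℝ (Fin n))}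
    (hF : perimeter F ≠ ∞) {φ : EuclideanSpace ℝ (Fin n) → ℝ} (hφ : ContDiff ℝ 1 φ)
    (hφc : HasCompactSupport φ) (hφ1 : ∀ x, |φ x| ≤ 1) (v : EuclideanSpace ℝ (Fin n)) :
    ∫ x in F, fderiv ℝ φ x v ≤ ‖v‖ * (perimeter F).toReal := by
  rcases eq_or_ne v 0 with rfl | hv
  · simp
  have hv' : 0 < ‖v‖ := norm_pos_iff.2 hv
  set w := ‖v‖⁻¹ • v with hw
  have hvw : v = ‖v‖ • w := by rw [hw, smul_inv_smul₀ hv'.ne']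
  have hw1 : ‖w‖ = 1 := by rw [hw, norm_smul, norm_inv, norm_norm, inv_mul_cancel₀ hv'.ne']
  have h := ofReal_setIntegral_divergence_le_perimeter (F := F) (g := fun z => φ z • w)
    (hφ.smul contDiff_const) hφc.smul_right
    (fun x => by simpa [norm_smul, hw1] using hφ1 x)
  simp_rw [divergence_smul_const hφ] at h
  rw [ENNReal.ofReal_le_iff_le_toReal hF] at h
  calc ∫ x in F, fderiv ℝ φ x v = ‖v‖ * ∫ x in F, fderiv ℝ φ x w := by
        rw [← integral_const_mul]
        congr 1
        ext x
        conv_lhs => rw [hvw]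
        simp
    _ ≤ _ := by gcongr

theorem setIntegral_comp_sub_sub_le {F : Set (EuclideanSpace ℝ (Fin n))}
    (hFfin : volume F ≠ ∞)
    (hF : perimeter F ≠ ∞) {φ : EuclideanSpace ℝ (Fin n) → ℝ} (hφ : ContDiff ℝ 1 φ)
    (hφc : HasCompactSupport φ) (hφ1 : ∀ x, |φ x| ≤ 1) (y : EuclideanSpace ℝ (Fin n)) :
    (∫ x in F, φ (x - y)) - ∫ x in F, φ x ≤ ‖y‖ * (perimeter F).toReal := by
  have : IsFiniteMeasure (volume.restrict F) := isFiniteMeasure_restrict.2 hFfin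
  have hshift (t : ℝ) : ContDiff ℝ 1 (fun x : EuclideanSpace ℝ (Fin n) => φ (x - t • y)) :=
    hφ.comp (contDiff_id.sub contDiff_const)
  have hshift' (t : ℝ) (x) : fderiv ℝ (fun x => φ (x - t • y)) x = fderiv ℝ φ (x - t • y) := by
    simp_rw [sub_eq_add_neg]
    exact fderiv_comp_add_right _
  have hshiftc (t : ℝ) : HasCompactSupport (fun x : EuclideanSpace ℝ (Fin n) => φ (x - t • y)) :=
    hφc.comp_homeomorph (Homeomorph.subRight (t • y))
  obtain ⟨M, hM⟩ : ∃ M, ∀ x, ‖fderiv ℝ φ x‖ ≤ M :=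
    (hφc.fderiv ℝ).exists_bound_of_continuous (hφ.continuous_fderiv one_ne_zero)
  have hder (t : ℝ) : HasDerivAt (fun t : ℝ => ∫ x in F, φ (x - t • y))
      (∫ x in F, fderiv ℝ φ (x - t • y) (-y)) t := by
    refine (hasDerivAt_integral_of_dominated_loc_of_deriv_le (bound := fun _ => M * ‖y‖)
      (F' := fun t x => fderiv ℝ φ (x - t • y) (-y)) univ_mem ?_ ?_ ?_ ?_ ?_ ?_).2
    · exact .of_forall fun t => (hshift t).continuous.aestronglyMeasurable
    · exact Integrable.of_bound (hshift t).continuous.aestronglyMeasurable 1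
        (.of_forall fun x => hφ1 _)
    · have := hφ.continuous_fderiv one_ne_zero
      exact Continuous.aestronglyMeasurable (by fun_prop)
    · refine .of_forall fun x t _ => ?_
      refine (ContinuousLinearMap.le_opNorm _ _).trans ?_
      rw [norm_neg]
      gcongr
      exact hM _
    · exact integrable_const _
    · refine .of_forall fun x t _ => ?_
      have h1 : HasDerivAt (fun t : ℝ => x - t • y) (-y) t := by
        simpa using ((hasDerivAt_id t).smul_const y).const_sub x
      exact ((hφ.differentiable one_ne_zero) _).hasFDerivAt.comp_hasDerivAt t h1
  have := image_sub_le_mul_sub_of_deriv_le (f := fun t : ℝ => ∫ x in F, φ (x - t • y))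
    (C := ‖y‖ * (perimeter F).toReal) (fun t => (hder t).differentiableAt) (fun t => by
      rw [(hder t).deriv, ← norm_neg y]
      simp_rw [← hshift']
      exact setIntegral_fderiv_apply_le hF (hshift t) (hshiftc t) (fun x => hφ1 _) (-y))
    zero_le_one
  simpa using this

theorem exists_contDiff_hasCompactSupport_between {K U : Set (EuclideanSpace ℝ (Fin n))}
    (hK : IsCompact K) (hU : IsOpen U) (hKU : K ⊆ U) :
    ∃ φ : EuclideanSpace ℝ (Fin n) → ℝ, ContDiff ℝ 1 φ ∧ HasCompactSupport φ ∧
      (∀ x, φ x ∈ Icc (0 : ℝ) 1) ∧ (∀ x ∈ K, φ x = 1) ∧ ∀ x ∉ U, φ x = 0 := by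
  obtain ⟨L, hL, hKL, hLU⟩ := exists_compact_between hK hU hKU
  obtain ⟨φ, hφ, hr, hs, h1⟩ := exists_contMDiff_support_eq_eq_one_iff (n := 1)
    𝓘(ℝ, EuclideanSpace ℝ (Fin n)) isOpen_interior hK.isClosed hKL
  refine ⟨φ, contMDiff_iff_contDiff.1 hφ, ?_, fun x => hr (mem_range_self x),
    fun x hx => (h1 x).1 hx, fun x hx => ?_⟩
  · refine HasCompactSupport.intro hL fun x hx => ?_
    rw [← Function.notMem_support, hs]
    exact fun h => hx (interior_subset h)
  · rw [← Function.notMem_support, hs]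
    exact fun h => hx (hLU (interior_subset h))

theorem volume_translate_diff_le {F : Set (EuclideanSpace ℝ (Fin n))} (hFm : MeasurableSet F)
    (hFfin : volume F ≠ ∞) (y : EuclideanSpace ℝ (Fin n)) :
    volume ({x | x + y ∈ F} \ F) ≤ ENNReal.ofReal ‖y‖ * perimeter F := by
  rcases eq_or_ne y 0 with rfl | hy
  · simp
  by_cases hF : perimeter F = ∞
  · rw [hF, ENNReal.mul_top]
    · exact le_top
    · simpa using hy
  set G : Set (EuclideanSpace ℝ (Fin n)) := {x | x + y ∈ F} with hG
  have hGm : MeasurableSet G := hFm.preimage (measurable_add_const y)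
  have hGfin : volume G ≠ ∞ := by
    rw [hG, show {x | x + y ∈ F} = (fun x => x + y) ⁻¹' F from rfl, measure_preimage_add_right]
    exact hFfin
  have hA : MeasurableSet (G \ F) := hGm.diff hFm
  have hAfin : volume (G \ F) ≠ ∞ := measure_ne_top_of_subset sdiff_subset hGfin
  refine ENNReal.le_of_forall_pos_le_add fun ε hε _ => ?_
  have hε2 : ENNReal.ofReal (ε / 2) ≠ 0 := by simpa using hε
  obtain ⟨K, hKA, hK, hKε⟩ := hA.exists_isCompact_lt_add hAfin hε2
  obtain ⟨U, hAU, hU, hUfin, hUε⟩ := hA.exists_isOpen_sdiff_lt hAfin hε2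
  obtain ⟨φ, hφ, hφc, hφ01, hφK, hφU⟩ :=
    exists_contDiff_hasCompactSupport_between hK hU (hKA.trans hAU)
  have hφi : Integrable φ := hφ.continuous.integrable_of_hasCompactSupport hφc
  have key := setIntegral_comp_sub_sub_le hFfin hF hφ hφc
    (fun x => abs_le.2 ⟨by linarith [(hφ01 x).1], (hφ01 x).2⟩) y
  have e1 : ∫ x in F, φ (x - y) = ∫ x in G, φ x := by
    have := (measurePreserving_add_right volume y).setIntegral_preimage_emb
      (measurableEmbedding_addRight y) (fun x => φ (x - y)) F
    simp only [add_sub_cancel_right] at this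
    exact this.symm
  have e2 : volume.real K ≤ ∫ x in G, φ x := by
    calc volume.real K = ∫ x in K, φ x := by
          rw [setIntegral_congr_fun hK.measurableSet hφK]; simp
      _ ≤ ∫ x in G, φ x := setIntegral_mono_set hφi.integrableOn
          (.of_forall fun x => (hφ01 x).1) (hKA.trans sdiff_subset).eventuallyLE
  have e3 : ∫ x in F, φ x ≤ volume.real (U \ (G \ F)) := by
    have hm : MeasurableSet (U \ (G \ F)) := hU.measurableSet.diff hA
    calc ∫ x in F, φ x ≤ ∫ x in F, (U \ (G \ F)).indicator 1 x := by
          refine setIntegral_mono_on hφi.integrableOn ?_ hFm fun x hx => ?_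
          · exact ((integrable_indicator_iff hm).2
              (integrableOn_const (ne_top_of_lt hUε))).integrableOn
          · by_cases hxU : x ∈ U
            · rw [indicator_of_mem (show x ∈ U \ (G \ F) from ⟨hxU, fun h => h.2 hx⟩)]
              exact (hφ01 x).2
            · rw [hφU x hxU]
              exact indicator_nonneg (fun _ _ => zero_le_one) _
      _ = volume.real (F ∩ (U \ (G \ F))) := by
          rw [setIntegral_indicator hm]; simp
      _ ≤ _ := measureReal_mono inter_subset_right (ne_top_of_lt hUε)
  have hKfin : volume K ≠ ∞ := hK.measure_ne_top
  have e4 : volume.real (U \ (G \ F)) ≤ ε / 2 := by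
    refine ENNReal.toReal_le_of_le_ofReal (by positivity) hUε.le
  have e5 : volume.real (G \ F) ≤ volume.real K + ε / 2 := by
    have := ENNReal.toReal_mono (by finiteness) hKε.le
    rwa [ENNReal.toReal_add hKfin (by finiteness), ENNReal.toReal_ofReal (by positivity)] at this
  have e6 : volume.real (G \ F) ≤ ‖y‖ * (perimeter F).toReal + ε := by linarith
  rw [← ENNReal.ofReal_toReal hF, ← ENNReal.ofReal_mul (norm_nonneg _),
    ← ENNReal.ofReal_coe_nnreal, ← ENNReal.ofReal_add (by positivity) (by positivity)]
  exact (ENNReal.le_ofReal_iff_toReal_le hAfin (by positivity)).2 e6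

theorem measurableSet_straddle {F : Set (EuclideanSpace ℝ (Fin n))} (hFm : MeasurableSet F)
    (r : ℝ) :
    MeasurableSet {p : EuclideanSpace ℝ (Fin n) × EuclideanSpace ℝ (Fin n) |
      p.1 ∉ F ∧ p.2 ∈ F ∧ dist p.2 p.1 < r} :=
  (hFm.compl.preimage measurable_fst).inter ((hFm.preimage measurable_snd).inter
    (measurableSet_lt (measurable_snd.dist measurable_fst) measurable_const))

theorem volume_prod_straddle_le {F : Set (EuclideanSpace ℝ (Fin n))} (hFm : MeasurableSet F)
    (hFfin : volume F ≠ ∞) (r : ℝ) :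
    (volume.prod volume) {p : EuclideanSpace ℝ (Fin n) × EuclideanSpace ℝ (Fin n) |
        p.1 ∉ F ∧ p.2 ∈ F ∧ dist p.2 p.1 < r} ≤
      volume (ball (0 : EuclideanSpace ℝ (Fin n)) r) * (ENNReal.ofReal r * perimeter F) := by
  set D := {p : EuclideanSpace ℝ (Fin n) × EuclideanSpace ℝ (Fin n) |
        p.1 ∉ F ∧ p.2 ∈ F ∧ dist p.2 p.1 < r} with hD
  have hDm : MeasurableSet D := measurableSet_straddle hFm r
  have hmp := measurePreserving_prod_add (volume : Measure (EuclideanSpace ℝ (Fin n)))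
    (volume : Measure (EuclideanSpace ℝ (Fin n)))
  rw [← hmp.measure_preimage hDm.nullMeasurableSet,
    Measure.prod_apply_symm (hDm.preimage hmp.measurable)]
  calc _ ≤ ∫⁻ y, (ball (0 : EuclideanSpace ℝ (Fin n)) r).indicator
          (fun _ => ENNReal.ofReal r * perimeter F) y := by
        refine lintegral_mono fun y => ?_
        by_cases hy : y ∈ ball (0 : EuclideanSpace ℝ (Fin n)) r
        · rw [indicator_of_mem hy]
          refine (measure_mono ?_).trans ((volume_translate_diff_le hFm hFfin y).trans ?_)
          · exact fun x hx => ⟨hx.2.1, hx.1⟩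
          · gcongr
            exact (mem_ball_zero_iff.1 hy).le
        · rw [indicator_of_notMem hy, nonpos_iff_eq_zero]
          convert measure_empty (μ := volume)
          refine eq_empty_of_forall_notMem fun x hx => hy ?_
          simpa [hD] using hx.2.2
    _ = _ := by
        rw [lintegral_indicator_const measurableSet_ball, mul_comm]

theorem setLIntegral_compl_volume_ball_inter_le {F : Set (EuclideanSpace ℝ (Fin n))}
    (hFm : MeasurableSet F) (hFfin : volume F ≠ ∞) (r : ℝ) :
    ∫⁻ x in Fᶜ, volume (ball x r ∩ F) ≤
      volume (ball (0 : EuclideanSpace ℝ (Fin n)) r) * (ENNReal.ofReal r * perimeter F) := by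
  have h := volume_prod_straddle_le hFm hFfin r
  rw [Measure.prod_apply (measurableSet_straddle hFm r)] at h
  refine le_trans ?_ h
  rw [← lintegral_indicator hFm.compl]
  refine lintegral_mono fun x => indicator_apply_le' (fun hx => ?_) (fun _ => zero_le)
  exact measure_mono fun z hz => ⟨hx, hz.2, hz.1⟩

theorem setLIntegral_volume_ball_diff_le {F : Set (EuclideanSpace ℝ (Fin n))}
    (hFm : MeasurableSet F) (hFfin : volume F ≠ ∞) (r : ℝ) :
    ∫⁻ x in F, volume (ball x r \ F) ≤
      volume (ball (0 : EuclideanSpace ℝ (Fin n)) r) * (ENNReal.ofReal r * perimeter F) := by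
  have h := volume_prod_straddle_le hFm hFfin r
  rw [Measure.prod_apply_symm (measurableSet_straddle hFm r)] at h
  refine le_trans ?_ h
  rw [← lintegral_indicator hFm]
  refine lintegral_mono fun x => indicator_apply_le' (fun hx => ?_) (fun _ => zero_le)
  exact measure_mono fun z hz => ⟨hz.2, hx, by simpa [dist_comm] using hz.1⟩

/-- A weak isoperimetric inequality: sets filling at most half the volume of a ball of radius `r`
have perimeter at least `1 / (2 * r)` times their volume. -/
theorem volume_le_mul_perimeter {F : Set (EuclideanSpace ℝ (Fin n))} (hFm : MeasurableSet F)
    {r : ℝ} (hr : 0 < r) (hF : 2 * volume F ≤ volume (ball (0 : EuclideanSpace ℝ (Fin n)) r)) :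
    volume F ≤ 2 * (ENNReal.ofReal r * perimeter F) := by
  set m := volume (ball (0 : EuclideanSpace ℝ (Fin n)) r) with hm
  have hm0 : m ≠ 0 := (measure_ball_pos _ _ hr).ne'
  have hmt : m ≠ ∞ := measure_ball_lt_top.ne
  have hFfin : volume F ≠ ∞ := fun h => by simp [h, hmt] at hF
  have h1 : m / 2 * volume F ≤ ∫⁻ x in F, volume (ball x r \ F) := by
    rw [← setLIntegral_const]
    refine lintegral_mono fun x => ?_
    have h2 : m ≤ volume (ball x r \ F) + volume F := by
      rw [hm, ← Measure.addHaar_ball_center volume x r]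
      exact (measure_mono (by intro z hz; by_cases h : z ∈ F <;> simp_all)).trans
        (measure_union_le (ball x r \ F) F)
    have h3 : volume F ≤ m / 2 := by
      rw [ENNReal.le_div_iff_mul_le (by simp) (by simp), mul_comm]
      exact hF
    have h4 : m / 2 + m / 2 ≤ volume (ball x r \ F) + m / 2 := by
      rw [ENNReal.add_halves]
      exact h2.trans (by gcongr)
    exact (ENNReal.add_le_add_iff_right (by finiteness)).1 h4
  have h5 := h1.trans (setLIntegral_volume_ball_diff_le hFm hFfin r)
  have h6 : m * volume F ≤ m * (2 * (ENNReal.ofReal r * perimeter F)) := by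
    calc m * volume F = 2 * (m / 2 * volume F) := by
          rw [← mul_assoc, ENNReal.mul_div_cancel (by simp) (by simp)]
      _ ≤ 2 * (m * (ENNReal.ofReal r * perimeter F)) := by gcongr
      _ = _ := by ring
  exact (ENNReal.mul_le_mul_iff_right hm0 hmt).1 h6

theorem measurable_volume_inter_ball {F : Set (EuclideanSpace ℝ (Fin n))} (hFm : MeasurableSet F)
    (r : ℝ) : Measurable fun x => volume (F ∩ ball x r) :=
  measurable_measure_prodMk_left (s := {p : EuclideanSpace ℝ (Fin n) × EuclideanSpace ℝ (Fin n) |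
      p.2 ∈ F ∧ dist p.2 p.1 < r}) ((hFm.preimage measurable_snd).inter
    (measurableSet_lt (measurable_snd.dist measurable_fst) measurable_const))

theorem volume_ball_mul_volume_diff_le {A B Ω : Set (EuclideanSpace ℝ (Fin n))}
    (hA : MeasurableSet A) (hB : MeasurableSet B) (hAΩ : A ⊆ Ω) (hAfin : volume A ≠ ∞)
    (hBfin : volume B ≠ ∞) {r : ℝ} {β : EuclideanSpace ℝ (Fin n) → ℝ} (hβ : Measurable β) :
    volume (ball (0 : EuclideanSpace ℝ (Fin n)) r) * volume (A \ B) ≤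
      volume (ball (0 : EuclideanSpace ℝ (Fin n)) r) * (ENNReal.ofReal r * perimeter A) +
      volume (ball (0 : EuclideanSpace ℝ (Fin n)) r) * (ENNReal.ofReal r * perimeter B) +
      ((∫⁻ x in Ω, ENNReal.ofReal |volume.real (A ∩ ball x r) - β x|) +
        ∫⁻ x in Ω, ENNReal.ofReal |volume.real (B ∩ ball x r) - β x|) := by
  have hbA : Measurable fun x => volume.real (A ∩ ball x r) :=
    (measurable_volume_inter_ball hA r).ennreal_toReal
  have hbB := measurable_volume_inter_ball hB r
  have hdA : Measurable fun x => ENNReal.ofReal |volume.real (A ∩ ball x r) - β x| :=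
    (measurable_norm.comp (hbA.sub hβ)).ennreal_ofReal
  have hdB : Measurable fun x => ENNReal.ofReal |volume.real (B ∩ ball x r) - β x| :=
    (measurable_norm.comp (hbB.ennreal_toReal.sub hβ)).ennreal_ofReal
  have key (x : EuclideanSpace ℝ (Fin n)) :
      volume (ball (0 : EuclideanSpace ℝ (Fin n)) r) ≤ volume (ball x r \ A) +
        (volume (B ∩ ball x r) + (ENNReal.ofReal |volume.real (A ∩ ball x r) - β x| +
          ENNReal.ofReal |volume.real (B ∩ ball x r) - β x|)) := by
    have hA' : volume (A ∩ ball x r) ≠ ∞ := measure_ne_top_of_subset inter_subset_left hAfin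
    have hB' : volume (B ∩ ball x r) ≠ ∞ := measure_ne_top_of_subset inter_subset_left hBfin
    rw [← Measure.addHaar_ball_center volume x r, ← measure_sdiff_add_inter (ball x r) hA,
      inter_comm (ball x r) A]
    gcongr
    rw [← ENNReal.ofReal_toReal hA', ← ENNReal.ofReal_toReal hB',
      ← ENNReal.ofReal_add (abs_nonneg _) (abs_nonneg _),
      ← ENNReal.ofReal_add ENNReal.toReal_nonneg (by positivity)]
    refine ENNReal.ofReal_le_ofReal ?_
    change volume.real _ ≤ volume.real _ + _
    have h1 := le_abs_self (volume.real (A ∩ ball x r) - β x)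
    have h2 := neg_abs_le (volume.real (B ∩ ball x r) - β x)
    linarith
  rw [← setLIntegral_const]
  refine (lintegral_mono key).trans ?_
  rw [lintegral_add_right, lintegral_add_left hbB, lintegral_add_left, ← add_assoc]
  · gcongr
    · exact (lintegral_mono_set sdiff_subset).trans (setLIntegral_volume_ball_diff_le hA hAfin r)
    · simp_rw [inter_comm B]
      exact (lintegral_mono_set fun x hx => hx.2).trans
        (setLIntegral_compl_volume_ball_inter_le hB hBfin r)
    · exact sdiff_subset.trans hAΩ
    · exact sdiff_subset.trans hAΩ
  · exact hdA
  · exact hbB.add (hdA.add hdB)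

theorem exists_forall_volume_diff_le {Ω : Set (EuclideanSpace ℝ (Fin n))} (hΩ : volume Ω ≠ ∞)
    {E : ℕ → Set (EuclideanSpace ℝ (Fin n))} (hE : ∀ k, MeasurableSet (E k))
    (hEΩ : ∀ k, E k ⊆ Ω) {C : ℝ≥0∞} (hC : C ≠ ∞) (hP : ∀ k, perimeter (E k) ≤ C)
    (hlim : ∀ x r, ∃ l : ℝ, Tendsto (fun k => volume.real (E k ∩ ball x r)) atTop (𝓝 l))
    {ε : ℝ≥0∞} (hε : 0 < ε) :
    ∃ N, ∀ k ≥ N, ∀ l ≥ N, volume (E k \ E l) ≤ ε := by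
  have hfin (k) : volume (E k) ≠ ∞ := measure_ne_top_of_subset (hEΩ k) hΩ
  obtain ⟨r, hr, hrC⟩ := ENNReal.exists_nnreal_pos_mul_lt hC
    (ENNReal.div_ne_zero.2 ⟨hε.ne', by simp⟩ : ε / 4 ≠ 0)
  choose β hβ using fun x => hlim x r
  set m := volume (ball (0 : EuclideanSpace ℝ (Fin n)) r) with hm
  have hm0 : m ≠ 0 := (measure_ball_pos _ _ (by exact_mod_cast hr)).ne'
  have hmt : m ≠ ∞ := measure_ball_lt_top.ne
  have hbm (k) : Measurable fun x => volume.real (E k ∩ ball x r) :=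
    (measurable_volume_inter_ball (hE k) r).ennreal_toReal
  have hβm : Measurable β := measurable_of_tendsto_metrizable hbm (tendsto_pi_nhds.2 hβ)
  have hb (k x) : volume.real (E k ∩ ball x r) ∈ Icc 0 m.toReal :=
    ⟨measureReal_nonneg, ENNReal.toReal_mono hmt (by
      rw [hm, ← Measure.addHaar_ball_center volume x r]
      exact measure_mono inter_subset_right)⟩
  have hβI (x) : β x ∈ Icc 0 m.toReal :=
    isClosed_Icc.mem_of_tendsto (hβ x) (.of_forall fun k => hb k x)
  have hd : Tendsto (fun k => ∫⁻ x in Ω, ENNReal.ofReal |volume.real (E k ∩ ball x r) - β x|)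
      atTop (𝓝 0) := by
    have := tendsto_lintegral_of_dominated_convergence (μ := volume.restrict Ω)
      (F := fun k x => ENNReal.ofReal |volume.real (E k ∩ ball x r) - β x|) (f := fun _ => 0)
      (fun _ => m) (fun k => (measurable_norm.comp ((hbm k).sub hβm)).ennreal_ofReal)
      (fun k => .of_forall fun x => ?_) ?_ (.of_forall fun x => ?_)
    · simpa using this
    · rw [← ENNReal.ofReal_toReal hmt]
      refine ENNReal.ofReal_le_ofReal (abs_le.2 ⟨?_, ?_⟩) <;>
      linarith [(hb k x).1, (hb k x).2, (hβI x).1, (hβI x).2]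
    · rw [setLIntegral_const]
      finiteness
    · have := ((hβ x).sub_const (β x)).abs
      simpa using ENNReal.tendsto_ofReal this
  obtain ⟨N, hN⟩ := eventually_atTop.1 (hd.eventually_le_const
    (show (0 : ℝ≥0∞) < m * (ε / 4) from pos_iff_ne_zero.2 (mul_ne_zero hm0
      (ENNReal.div_ne_zero.2 ⟨hε.ne', by simp⟩))))
  refine ⟨N, fun k hk l hl => (ENNReal.mul_le_mul_iff_right hm0 hmt).1 ?_⟩
  have hPk (k) : ENNReal.ofReal (r : ℝ) * perimeter (E k) ≤ ε / 4 := by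
    rw [ENNReal.ofReal_coe_nnreal]
    exact (by gcongr; exact hP k : _ ≤ (r : ℝ≥0∞) * C).trans hrC.le
  calc m * volume (E k \ E l) ≤ _ :=
        volume_ball_mul_volume_diff_le (hE k) (hE l) (hEΩ k) (hfin k) (hfin l) hβm
    _ ≤ m * (ε / 4) + m * (ε / 4) + (m * (ε / 4) + m * (ε / 4)) := by
        gcongr
        exacts [hPk k, hPk l, hN k hk, hN l hl]
    _ = m * (4 * (ε / 4)) := by ring
    _ = m * ε := by rw [ENNReal.mul_div_cancel (by simp) (by simp)]

theorem exists_subseq_ae_tendsto_of_perimeter_le {Ω : Set (EuclideanSpace ℝ (Fin n))}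
    (hΩ : volume Ω ≠ ∞) {E : ℕ → Set (EuclideanSpace ℝ (Fin n))}
    (hE : ∀ k, MeasurableSet (E k)) (hEΩ : ∀ k, E k ⊆ Ω) {C : ℝ≥0∞} (hC : C ≠ ∞)
    (hP : ∀ k, perimeter (E k) ≤ C) :
    ∃ φ : ℕ → ℕ, StrictMono φ ∧ ∃ E₀, MeasurableSet E₀ ∧ E₀ ⊆ Ω ∧
      ∀ᵐ x, ∀ᶠ k in atTop, (x ∈ E (φ k) ↔ x ∈ E₀) := by
  obtain ⟨φ, hφ, hl⟩ := exists_subseq_tendsto_measureReal_inter hΩ hE hEΩ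
  obtain ⟨ψ, hψ, h⟩ := exists_subseq_ae_eventually_mem_iff (E := fun k => E (φ k)) (μ := volume)
    fun ε hε => exists_forall_volume_diff_le hΩ (fun k => hE (φ k)) (fun k => hEΩ (φ k)) hC
      (fun k => hP (φ k)) (fun x r => hl _ measurableSet_ball measure_ball_lt_top.ne) hε
  refine ⟨φ ∘ ψ, hφ.comp hψ, _, MeasurableSet.measurableSet_liminf fun k => hE _, ?_, h⟩
  intro x hx
  obtain ⟨k, hk⟩ := (mem_liminf_iff_eventually_mem.1 hx).exists
  exact hEΩ _ hk

theorem integrable_divergence {g : EuclideanSpace ℝ (Fin n) → EuclideanSpace ℝ (Fin n)}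
    (hg : ContDiff ℝ 1 g) (hgc : HasCompactSupport g) : Integrable (divergence g) := by
  let T : (EuclideanSpace ℝ (Fin n) →L[ℝ] EuclideanSpace ℝ (Fin n)) →ₗ[ℝ] ℝ :=
    LinearMap.trace ℝ (EuclideanSpace ℝ (Fin n)) ∘ₗ ContinuousLinearMap.coeLM ℝ
  have hT : Continuous T := T.continuous_of_finiteDimensional
  exact (hT.comp (hg.continuous_fderiv one_ne_zero)).integrable_of_hasCompactSupport
    ((hgc.fderiv ℝ).comp_left (g := T) (map_zero T))

/-- Lower semicontinuity of the perimeter under almost everywhere convergence. -/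
theorem perimeter_le_of_ae_tendsto {E : ℕ → Set (EuclideanSpace ℝ (Fin n))}
    {E₀ : Set (EuclideanSpace ℝ (Fin n))} (hE : ∀ k, MeasurableSet (E k))
    (hE₀ : MeasurableSet E₀) (h : ∀ᵐ x, ∀ᶠ k in atTop, (x ∈ E k ↔ x ∈ E₀))
    {c : ℕ → ℝ≥0∞} {c₀ : ℝ≥0∞} (hc : Tendsto c atTop (𝓝 c₀))
    (hP : ∀ k, perimeter (E k) ≤ c k) : perimeter E₀ ≤ c₀ := by
  refine iSup₂_le fun g hg => ?_
  obtain ⟨hg, hgc, hg1⟩ := hg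
  have hi := integrable_divergence hg hgc
  have hlim : Tendsto (fun k => ∫ x in E k, divergence g x) atTop
      (𝓝 (∫ x in E₀, divergence g x)) := by
    simp_rw [← integral_indicator (hE _), ← integral_indicator hE₀]
    refine tendsto_integral_of_dominated_convergence (fun x => ‖divergence g x‖)
      (fun k => hi.aestronglyMeasurable.indicator (hE k)) hi.norm
      (fun k => .of_forall fun x => norm_indicator_le_norm_self _ _) ?_
    filter_upwards [h] with x hx
    refine tendsto_const_nhds.congr' ?_
    filter_upwards [hx] with k hk
    classical
    simp only [indicator_apply, hk]
  exact le_of_tendsto_of_tendsto' (ENNReal.tendsto_ofReal hlim) hc fun k =>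
    (ofReal_setIntegral_divergence_le_perimeter hg hgc hg1).trans (hP k)

theorem cheegerConstant_le {Ω F : Set (EuclideanSpace ℝ (Fin n))} (hF : MeasurableSet F)
    (hFΩ : F ⊆ Ω) (hF0 : 0 < volume F) : cheegerConstant Ω ≤ perimeter F / volume F :=
  iInf₂_le (f := fun F _ => perimeter F / volume F) F ⟨hF, hFΩ, hF0⟩

/-- Sets with a bounded ratio of perimeter to volume have volume bounded from below. -/
theorem exists_pos_le_volume_of_perimeter_le {c : ℝ≥0∞} (hc : c ≠ ∞) :
    ∃ δ : ℝ≥0∞, 0 < δ ∧ ∀ F : Set (EuclideanSpace ℝ (Fin n)), MeasurableSet F →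
      0 < volume F → perimeter F ≤ c * volume F → δ ≤ volume F := by
  obtain ⟨r, hr, hrc⟩ := ENNReal.exists_nnreal_pos_mul_lt (a := 2 * c) (by finiteness) one_ne_zero
  refine ⟨volume (ball (0 : EuclideanSpace ℝ (Fin n)) r) / 2,
    ENNReal.div_pos (measure_ball_pos _ _ (by exact_mod_cast hr)).ne' (by simp),
    fun F hF hF0 hP => ?_⟩
  by_contra! hlt
  have hle : 2 * volume F ≤ volume (ball (0 : EuclideanSpace ℝ (Fin n)) r) := by
    rw [mul_comm]
    exact (ENNReal.le_div_iff_mul_le (by simp) (by simp)).1 hlt.le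
  have h1 := volume_le_mul_perimeter hF (NNReal.coe_pos.2 hr) hle
  have h2 : volume F ≤ r * (2 * c) * volume F := by
    refine h1.trans ?_
    rw [ENNReal.ofReal_coe_nnreal]
    calc 2 * (r * perimeter F) ≤ 2 * (r * (c * volume F)) := by gcongr
      _ = _ := by ring
  have h3 := ENNReal.mul_lt_mul_left hF0.ne' hlt.ne_top hrc
  rw [one_mul] at h3
  exact absurd h2 h3.not_ge

end Perimeter

/-- **Existence of Cheeger sets.** Every nonempty bounded open set `Ω ⊆ ℝⁿ` (`n ≥ 2`) admits
a (possibly non-unique) Cheeger set, i.e. a Borel set `E ⊆ Ω` with `|E| > 0` and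
`P(E)/|E| = h(Ω)`. -/
theorem exists_cheegerSet {n : ℕ} (hn : 2 ≤ n)
    (Ω : Set (EuclideanSpace ℝ (Fin n)))
    (hΩne : Ω.Nonempty) (hΩop : IsOpen Ω) (hΩbd : Bornology.IsBounded Ω) :
    ∃ E : Set (EuclideanSpace ℝ (Fin n)), IsCheegerSet Ω E := by
  have hΩ : volume Ω ≠ ∞ := hΩbd.measure_lt_top.ne
  have hΩ0 : 0 < volume Ω := hΩop.measure_pos volume hΩne
  set h := cheegerConstant Ω with hh
  by_cases hfin : h = ∞
  · refine ⟨Ω, hΩop.measurableSet, subset_rfl, hΩ0, ?_⟩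
    have := cheegerConstant_le hΩop.measurableSet subset_rfl hΩ0
    rw [← hh, hfin, top_le_iff] at this
    rw [this, ← hh, hfin]
  have hex (k : ℕ) : ∃ F, MeasurableSet F ∧ F ⊆ Ω ∧ 0 < volume F ∧
      perimeter F ≤ (h + ((k : ℝ≥0∞) + 1)⁻¹) * volume F := by
    have hlt : h < h + ((k : ℝ≥0∞) + 1)⁻¹ := ENNReal.lt_add_right hfin (by simp)
    obtain ⟨F, hF'⟩ := iInf_lt_iff.1 hlt
    obtain ⟨⟨hF, hFΩ, hF0⟩, hlt⟩ := iInf_lt_iff.1 hF'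
    exact ⟨F, hF, hFΩ, hF0, (ENNReal.div_le_iff hF0.ne'
      (measure_ne_top_of_subset hFΩ hΩ)).1 hlt.le⟩
  choose E hE hEΩ hE0 hP using hex
  have hP1 (k) : perimeter (E k) ≤ (h + 1) * volume (E k) := by
    refine (hP k).trans ?_
    gcongr
    rw [ENNReal.inv_le_one]
    exact le_add_self
  obtain ⟨φ, hφ, E₀, hE₀, hE₀Ω, hlim⟩ := exists_subseq_ae_tendsto_of_perimeter_le hΩ hE hEΩ
    (C := (h + 1) * volume Ω) (by finiteness)
    (fun k => (hP1 k).trans (by gcongr; exact hEΩ k))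
  have hvol : Tendsto (fun k => volume (E (φ k))) atTop (𝓝 (volume E₀)) :=
    tendsto_measure_of_ae_tendsto_indicator atTop hE₀ (fun k => hE _) hΩop.measurableSet hΩ
      (.of_forall fun k => hEΩ _) hlim
  obtain ⟨δ, hδ, hδle⟩ := exists_pos_le_volume_of_perimeter_le (n := n) (c := h + 1) (by finiteness)
  have hE₀0 : 0 < volume E₀ := hδ.trans_le (ge_of_tendsto' hvol fun k =>
    hδle _ (hE _) (hE0 _) (hP1 _))
  have hE₀fin : volume E₀ ≠ ∞ := measure_ne_top_of_subset hE₀Ω hΩ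
  have ht : Tendsto (fun k => h + ((φ k : ℝ≥0∞) + 1)⁻¹) atTop (𝓝 h) := by
    have h1 : Tendsto (fun k : ℕ => ((k : ℝ≥0∞) + 1)⁻¹) atTop (𝓝 0) := by
      have := (tendsto_add_atTop_iff_nat 1).2 ENNReal.tendsto_inv_nat_nhds_zero
      simpa using this
    simpa using (h1.comp hφ.tendsto_atTop).const_add h
  have hP₀ : perimeter E₀ ≤ h * volume E₀ :=
    perimeter_le_of_ae_tendsto (fun k => hE (φ k)) hE₀ hlim
      (ENNReal.Tendsto.mul ht (.inr hE₀fin) hvol (.inr hfin)) (fun k => hP (φ k))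
  exact ⟨E₀, hE₀, hE₀Ω, hE₀0, le_antisymm ((ENNReal.div_le_iff hE₀0.ne' hE₀fin).2 hP₀)
    (cheegerConstant_le hE₀ hE₀Ω hE₀0)⟩
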